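/- arXiv:2303.10591 — 10 statements merged into one kernel-verified Lean document; each statement's English description precedes it below -/
import Mathlib

section
/- (Combinatorial content of Theorem 5.1(1), raising case.) Let B be a skew-symmetric n×n integer matrix, u ∈ {1,…,n}, and δ, ε, γ ∈ ℤ^n. Set λ := δ + ε + γB, and define γ' ∈ ℤ^n by γ'(v) = γ(v) for all v ≠ u and γ'(u) = γ[b_u]_+ − γ(u) + [δ(u)]_+ + [ε(u)]_+ − [λ(u)]_+. Then μ_u(λ) = μ_u(δ) + μ_u(ε) + γ'·μ_u(B), where on vectors μ_u denotes δ-vector mutation with respect to B and μ_u(B) is the matrix mutation of B. -/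
open Matrix

/-- `[x]₊ = max(x,0)` for an integer `x`. -/
def zpos (x : ℤ) : ℤ := max x 0

/-- Matrix mutation `μ_u(B)` at the vertex `u`. -/
def matMut {n : ℕ} (B : Matrix (Fin n) (Fin n) ℤ) (u : Fin n) : Matrix (Fin n) (Fin n) ℤ :=
  fun v w =>
    if v = u ∨ w = u then -B v w
    else B v w + zpos (B v u) * zpos (B u w) - zpos (-B v u) * zpos (-B u w)

/-- δ-vector mutation `μ_u(δ)` with respect to `B`. -/
def deltaMut {n : ℕ} (B : Matrix (Fin n) (Fin n) ℤ) (u : Fin n) (δ : Fin n → ℤ) : Fin n → ℤ :=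
  fun v => if v = u then -δ u else δ v + zpos (-B u v) * δ u + B u v * zpos (δ u)

/-- check-vector mutation `μ̌_u(ε̌)` with respect to `B`. -/
def checkMut {n : ℕ} (B : Matrix (Fin n) (Fin n) ℤ) (u : Fin n) (ε : Fin n → ℤ) : Fin n → ℤ :=
  fun v => if v = u then -ε u else ε v + zpos (-B u v) * ε u - B u v * zpos (-ε u)

/-- Row vector times matrix: `(γB)(w) = Σ_v γ(v) b_{v,w}`. -/
def rowMul {n : ℕ} (γ : Fin n → ℤ) (B : Matrix (Fin n) (Fin n) ℤ) : Fin n → ℤ :=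
  fun w => ∑ v, γ v * B v w

/-- Dot product of two integer vectors. -/
def dotProd {n : ℕ} (a b : Fin n → ℤ) : ℤ := ∑ v, a v * b v

/-- `γ[b_u]₊ = Σ_v γ(v) [b_{v,u}]₊`, where `b_u` is the `u`-th column of `B`. -/
def posPair {n : ℕ} (γ : Fin n → ℤ) (B : Matrix (Fin n) (Fin n) ℤ) (u : Fin n) : ℤ :=
  ∑ v, γ v * zpos (B v u)

lemma zpos_neg_eq (x : ℤ) : zpos (-x) = zpos x - x := by
  unfold zpos
  omega

/-- Theorem 5.1(1), raising case: the mutation formula for the general rank vector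
is compatible with the defining relation `λ = δ + ε + γB`. -/
theorem raising_mutation_formula {n : ℕ} (B : Matrix (Fin n) (Fin n) ℤ)
    (hB : Bᵀ = -B) (u : Fin n) (δ ε γ lam γ' : Fin n → ℤ)
    (hlam : lam = fun w => δ w + ε w + rowMul γ B w)
    (hγ'ne : ∀ v, v ≠ u → γ' v = γ v)
    (hγ'u : γ' u = posPair γ B u - γ u + zpos (δ u) + zpos (ε u) - zpos (lam u)) :
    deltaMut B u lam =
      fun w => deltaMut B u δ w + deltaMut B u ε w + rowMul γ' (matMut B u) w := by
  have hskew : ∀ i j, B j i = -B i j := fun i j => congrFun (congrFun hB i) j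
  have huu : B u u = 0 := by have := hskew u u; omega
  funext w
  by_cases hw : w = u
  · subst hw
    have key : rowMul γ' (matMut B w) w = -rowMul γ B w := by
      simp only [rowMul, ← Finset.sum_neg_distrib]
      refine Finset.sum_congr rfl fun v _ => ?_
      by_cases hv : v = w
      · subst hv; simp [matMut, huu]
      · simp [matMut, hγ'ne v hv]
    rw [key]
    simp only [deltaMut, if_true, hlam]
    ring
  · have key : rowMul γ' (matMut B u) w = rowMul γ B w + zpos (-B u w) * rowMul γ B u
        + B u w * posPair γ B u - (γ' u + γ u) * B u w := by
      have h1 : (γ' u + γ u) * B u w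
          = ∑ v, if v = u then (γ' u + γ u) * B u w else 0 := by simp
      rw [h1]
      simp only [rowMul, posPair, Finset.mul_sum, ← Finset.sum_add_distrib,
        ← Finset.sum_sub_distrib]
      refine Finset.sum_congr rfl fun v _ => ?_
      by_cases hv : v = u
      · subst hv
        simp [matMut, huu, zpos]
        ring
      · simp only [matMut, hv, hw, or_self, if_false, hγ'ne v hv, zpos_neg_eq]
        ring
    have hl : ∀ x, lam x = δ x + ε x + rowMul γ B x := fun x => by rw [hlam]
    simp only [deltaMut, hw, if_false]
    rw [key, hγ'u, hl w]
    linear_combination zpos (-B u w) * hl u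
end

section
/- (Combinatorial content of Theorem 5.1(2), lowering case.) Let B be a skew-symmetric n×n integer matrix, u ∈ {1,…,n}, and δ, ε̌, γ ∈ ℤ^n. Set λ := δ − ε̌ + γB, and define γ' ∈ ℤ^n by γ'(v) = γ(v) for all v ≠ u and γ'(u) = γ[b_u]_+ − γ(u) + [δ(u)]_+ + [−ε̌(u)]_+ − [λ(u)]_+. Then μ_u(λ) = μ_u(δ) − μ̌_u(ε̌) + γ'·μ_u(B), where μ_u denotes δ-vector mutation with respect to B, μ̌_u denotes check-vector mutation with respect to B, and μ_u(B) is the matrix mutation of B. -/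
open Matrix

/-- Theorem 5.1(2), lowering case: the mutation formula for the general rank vector
is compatible with the defining relation `λ = δ - ε̌ + γB`. -/
theorem lowering_mutation_formula {n : ℕ} (B : Matrix (Fin n) (Fin n) ℤ)
    (hB : Bᵀ = -B) (u : Fin n) (δ εc γ lam γ' : Fin n → ℤ)
    (hlam : lam = fun w => δ w - εc w + rowMul γ B w)
    (hγ'ne : ∀ v, v ≠ u → γ' v = γ v)
    (hγ'u : γ' u = posPair γ B u - γ u + zpos (δ u) + zpos (-εc u) - zpos (lam u)) :
    deltaMut B u lam =
      fun w => deltaMut B u δ w - checkMut B u εc w + rowMul γ' (matMut B u) w := by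
  have hs : ∀ v w, B w v = - B v w := fun v w => congrFun (congrFun hB v) w
  have huu : B u u = 0 := by have := hs u u; omega
  have hz : ∀ x : ℤ, zpos x - zpos (-x) = x := by
    intro x; unfold zpos; omega
  have hz0 : zpos 0 = 0 := by simp [zpos]
  funext w
  by_cases hw : w = u
  · subst hw
    have h1 : rowMul γ' (matMut B w) w = - rowMul γ B w := by
      unfold rowMul
      rw [← Finset.sum_neg_distrib]
      refine Finset.sum_congr rfl fun v _ => ?_
      by_cases hv : v = w
      · subst hv; simp [matMut, huu]
      · simp [matMut, hγ'ne v hv]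
    simp only [deltaMut, checkMut, if_true, h1, hlam]
    ring
  · have h1 : rowMul γ' (matMut B u) w = rowMul γ B w + zpos (-B u w) * rowMul γ B u
        + B u w * posPair γ B u - (γ' u + γ u) * B u w := by
      have h2 : (γ' u + γ u) * B u w = ∑ v, if v = u then (γ' u + γ u) * B u w else 0 := by
        simp
      rw [h2]
      unfold rowMul posPair
      rw [Finset.mul_sum, Finset.mul_sum, ← Finset.sum_add_distrib, ← Finset.sum_add_distrib,
        ← Finset.sum_sub_distrib]
      refine Finset.sum_congr rfl fun v _ => ?_
      by_cases hv : v = u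
      · subst hv
        simp only [matMut, huu, hz0, true_or, if_true]
        ring
      · simp only [matMut, hv, hw, or_self, if_false, hγ'ne v hv]
        have e1 := hz (B u w)
        have e2 := hz (B v u)
        linear_combination γ v * zpos (B v u) * e1 + γ v * zpos (-B u w) * e2
    have hl : ∀ w, lam w = δ w - εc w + rowMul γ B w := fun w => by rw [hlam]
    simp only [deltaMut, checkMut, hw, if_false, h1]
    rw [hγ'u, hl w]
    linear_combination zpos (-B u w) * hl u
end

section
/- (Theorem 5.1(2), uniqueness form.) Let B be a skew-symmetric n×n integer matrix, u ∈ {1,…,n}, and δ, ε̌, γ ∈ ℤ^n, and set λ := δ − ε̌ + γB. Assume that the mutated matrix μ_u(B) has rank n over ℚ (i.e. right multiplication by μ_u(B) is injective on ℚ^n). If γ'' ∈ ℤ^n satisfies μ_u(λ) = μ_u(δ) − μ̌_u(ε̌) + γ''·μ_u(B), then γ''(v) = γ(v) for all v ≠ u and γ''(u) = γ[b_u]_+ − γ(u) + [δ(u)]_+ + [−ε̌(u)]_+ − [λ(u)]_+. -/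
open Matrix

/-- Theorem 5.1(2), uniqueness form: if `μ_u(B)` has full rank over `ℚ` then the
vector `γ''` appearing in the mutated relation is uniquely determined. -/
theorem lowering_mutation_formula_unique {n : ℕ} (B : Matrix (Fin n) (Fin n) ℤ)
    (hB : Bᵀ = -B) (u : Fin n) (δ εc γ lam : Fin n → ℤ)
    (hlam : lam = fun w => δ w - εc w + rowMul γ B w)
    (hrank : Function.Injective
      (fun x : Fin n → ℚ => fun w => ∑ v, x v * ((matMut B u) v w : ℚ)))
    (γ'' : Fin n → ℤ)
    (heq : deltaMut B u lam =
      fun w => deltaMut B u δ w - checkMut B u εc w + rowMul γ'' (matMut B u) w) :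
    (∀ v, v ≠ u → γ'' v = γ v) ∧
      γ'' u = posPair γ B u - γ u + zpos (δ u) + zpos (-εc u) - zpos (lam u) := by
  have huu : B u u = 0 := by
    have h := congrFun (congrFun hB u) u
    simp only [Matrix.transpose_apply, Matrix.neg_apply] at h
    omega
  have hz : ∀ x : ℤ, zpos x - zpos (-x) = x := by
    intro x
    unfold zpos
    omega
  have hz0 : zpos 0 = 0 := by simp [zpos]
  set c : ℤ := posPair γ B u - γ u + zpos (δ u) + zpos (-εc u) - zpos (lam u) with hc
  have hupd : ∀ w, rowMul (Function.update γ u c) (matMut B u) w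
      = rowMul γ (matMut B u) w + (c - γ u) * matMut B u u w := by
    intro w
    unfold rowMul
    have h : ∀ v, Function.update γ u c v * matMut B u v w
        = γ v * matMut B u v w + (if v = u then (c - γ u) * matMut B u u w else 0) := by
      intro v
      by_cases hv : v = u
      · subst hv
        simp
        ring
      · simp [hv]
    simp_rw [h]
    rw [Finset.sum_add_distrib]
    simp
  have hP : posPair γ B u - ∑ v, γ v * zpos (-B v u) = rowMul γ B u := by
    unfold posPair rowMul
    rw [← Finset.sum_sub_distrib]
    refine Finset.sum_congr rfl fun v _ => ?_
    rw [← mul_sub, hz]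
  have hrow : ∀ w, w ≠ u → rowMul γ (matMut B u) w = rowMul γ B w
      + posPair γ B u * zpos (B u w) - (∑ v, γ v * zpos (-B v u)) * zpos (-B u w)
      - 2 * γ u * B u w := by
    intro w hw
    have h : ∀ v, γ v * matMut B u v w = γ v * B v w + γ v * zpos (B v u) * zpos (B u w)
        - γ v * zpos (-B v u) * zpos (-B u w) - (if v = u then 2 * γ u * B u w else 0) := by
      intro v
      by_cases hv : v = u
      · subst hv
        simp [matMut, huu, hz0]
        ring
      · simp [matMut, hv, hw]
        ring
    unfold rowMul posPair
    simp_rw [h]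
    rw [Finset.sum_sub_distrib, Finset.sum_sub_distrib, Finset.sum_add_distrib,
      Finset.sum_mul, Finset.sum_mul]
    simp
  have hlamw : ∀ w, lam w = δ w - εc w + rowMul γ B w := fun w => by rw [hlam]
  have key : ∀ w, rowMul (Function.update γ u c) (matMut B u) w
      = rowMul γ'' (matMut B u) w := by
    intro w
    have e := congrFun heq w
    rw [hupd]
    by_cases hw : w = u
    · subst hw
      have h1 : rowMul γ (matMut B w) w = - rowMul γ B w := by
        simp [rowMul, matMut]
      have h2 : matMut B w w w = 0 := by simp [matMut, huu]
      simp only [deltaMut, checkMut, if_true] at e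
      rw [h1, h2]
      linarith [hlamw w]
    · have h2 : matMut B u u w = - B u w := by simp [matMut]
      simp only [deltaMut, checkMut, if_neg hw] at e
      rw [hrow w hw, h2, hc]
      have hl := hlamw w
      have hlu := hlamw u
      have hb := hz (B u w)
      generalize zpos (lam u) = L at *
      rw [hl, hlu] at e
      linear_combination e + posPair γ B u * hb + zpos (-B u w) * hP
  have hfun := hrank (a₁ := fun v => ((Function.update γ u c v : ℤ) : ℚ))
    (a₂ := fun v => ((γ'' v : ℤ) : ℚ)) (by
      funext w
      have := key w
      unfold rowMul at this
      beta_reduce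
      exact_mod_cast this)
  have hfin : ∀ v, Function.update γ u c v = γ'' v := fun v => by
    exact_mod_cast congrFun hfun v
  refine ⟨fun v hv => ?_, ?_⟩
  · rw [← hfin v]
    simp [hv]
  · rw [← hfin u]
    simp
end

section
/- (Theorem 5.1(1), uniqueness form.) Let B be a skew-symmetric n×n integer matrix, u ∈ {1,…,n}, and δ, ε, γ ∈ ℤ^n, and set λ := δ + ε + γB. Assume that the mutated matrix μ_u(B) has rank n over ℚ (i.e. right multiplication by μ_u(B) is injective on ℚ^n). If γ'' ∈ ℤ^n satisfies μ_u(λ) = μ_u(δ) + μ_u(ε) + γ''·μ_u(B), then γ''(v) = γ(v) for all v ≠ u and γ''(u) = γ[b_u]_+ − γ(u) + [δ(u)]_+ + [ε(u)]_+ − [λ(u)]_+. -/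
open Matrix

/-- Theorem 5.1(1), uniqueness form: if `μ_u(B)` has full rank over `ℚ` then the
vector `γ''` appearing in the mutated relation is uniquely determined. -/
theorem raising_mutation_formula_unique {n : ℕ} (B : Matrix (Fin n) (Fin n) ℤ)
    (hB : Bᵀ = -B) (u : Fin n) (δ ε γ lam : Fin n → ℤ)
    (hlam : lam = fun w => δ w + ε w + rowMul γ B w)
    (hrank : Function.Injective
      (fun x : Fin n → ℚ => fun w => ∑ v, x v * ((matMut B u) v w : ℚ)))
    (γ'' : Fin n → ℤ)
    (heq : deltaMut B u lam =
      fun w => deltaMut B u δ w + deltaMut B u ε w + rowMul γ'' (matMut B u) w) :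
    (∀ v, v ≠ u → γ'' v = γ v) ∧
      γ'' u = posPair γ B u - γ u + zpos (δ u) + zpos (ε u) - zpos (lam u) := by
  have hskew : ∀ i j, B i j = -B j i := fun i j => by
    have := congrFun (congrFun hB j) i
    simpa using this
  have huu : B u u = 0 := by have := hskew u u; omega
  have hz : ∀ x : ℤ, zpos x - zpos (-x) = x := fun x => by unfold zpos; omega
  have hz0 : zpos 0 = 0 := by simp [zpos]
  obtain ⟨g, hg⟩ : ∃ g, g = posPair γ B u - γ u + zpos (δ u) + zpos (ε u) - zpos (lam u) :=
    ⟨_, rfl⟩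
  rw [← hg]
  have hpq : rowMul γ B u = posPair γ B u - ∑ v, γ v * zpos (-B v u) := by
    unfold rowMul posPair
    rw [← Finset.sum_sub_distrib]
    refine Finset.sum_congr rfl fun v _ => ?_
    rw [← mul_sub, hz]
  have key : ∀ w, rowMul (Function.update γ u g) (matMut B u) w
      = rowMul γ'' (matMut B u) w := by
    intro w
    have h := congrFun heq w
    by_cases hw : w = u
    · subst hw
      have h1 : rowMul (Function.update γ w g) (matMut B w) w = - rowMul γ B w := by
        unfold rowMul
        rw [← Finset.sum_neg_distrib]
        refine Finset.sum_congr rfl fun v _ => ?_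
        by_cases hv : v = w
        · subst hv; simp [matMut, huu]
        · simp [matMut, hv]
      simp only [deltaMut, if_true] at h
      have h2 := congrFun hlam w
      rw [h1]
      linarith
    · have h1 : rowMul (Function.update γ u g) (matMut B u) w
          = rowMul γ B w + posPair γ B u * zpos (B u w)
            - (∑ v, γ v * zpos (-B v u)) * zpos (-B u w) + (-(g + γ u) * B u w) := by
        have h3 : (-(g + γ u) * B u w) = ∑ v, if v = u then (-(g + γ u) * B u w) else 0 := by
          simp
        rw [h3]
        unfold rowMul posPair
        rw [Finset.sum_mul, Finset.sum_mul, ← Finset.sum_add_distrib,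
          ← Finset.sum_sub_distrib, ← Finset.sum_add_distrib]
        refine Finset.sum_congr rfl fun v _ => ?_
        by_cases hv : v = u
        · subst hv
          simp [matMut, huu, hz0]
          ring
        · simp [matMut, hv, hw]
          ring
      simp only [deltaMut, if_neg hw] at h
      have h2 := congrFun hlam w
      have h4 := congrFun hlam u
      have h5 := hz (B u w)
      rw [h1, hg]
      rw [hpq] at h4
      generalize (∑ v, γ v * zpos (-B v u)) = q at *
      generalize posPair γ B u = p at *
      generalize zpos (lam u) = L at *
      linear_combination h - h2 - zpos (-B u w) * h4 + p * h5
  have hinj : (fun v => ((Function.update γ u g v : ℤ) : ℚ)) = fun v => ((γ'' v : ℤ) : ℚ) := by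
    apply hrank
    funext w
    have := key w
    unfold rowMul at this
    beta_reduce
    exact_mod_cast this
  have hfin : ∀ v, Function.update γ u g v = γ'' v := fun v => by
    have := congrFun hinj v
    exact_mod_cast this
  refine ⟨fun v hv => ?_, ?_⟩
  · rw [← hfin v, Function.update_of_ne hv]
  · rw [← hfin u, Function.update_self]
end

section
/- (Combinatorial identity proved in Proposition 5.3 for the invariant ȟ_l.) Let B be a skew-symmetric n×n integer matrix, u ∈ {1,…,n}, and δ, ε̌, γ ∈ ℤ^n. Set λ := δ − ε̌ + γB, let δ' := μ_u(δ), and define γ' ∈ ℤ^n by γ'(v) = γ(v) for v ≠ u and γ'(u) = γ[b_u]_+ − γ(u) + [δ(u)]_+ + [−ε̌(u)]_+ − [λ(u)]_+. Then δ'·γ' − δ·γ = [δ(u)]_+[−λ(u)]_+ − [−δ(u)]_+[λ(u)]_+ − [δ(u)]_+[ε̌(u)]_+ + [−δ(u)]_+[−ε̌(u)]_+. -/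
open Matrix

theorem zpos_eq_aux (x : ℤ) : zpos x = x + zpos (-x) := by
  unfold zpos; omega

/-- Proposition 5.3, combinatorial identity for the invariant `ȟ_l`. -/
theorem hcheck_l_identity {n : ℕ} (B : Matrix (Fin n) (Fin n) ℤ)
    (hB : Bᵀ = -B) (u : Fin n) (δ εc γ lam γ' : Fin n → ℤ)
    (hlam : lam = fun w => δ w - εc w + rowMul γ B w)
    (hγ'ne : ∀ v, v ≠ u → γ' v = γ v)
    (hγ'u : γ' u = posPair γ B u - γ u + zpos (δ u) + zpos (-εc u) - zpos (lam u)) :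
    dotProd (deltaMut B u δ) γ' - dotProd δ γ =
      zpos (δ u) * zpos (-lam u) - zpos (-δ u) * zpos (lam u)
        - zpos (δ u) * zpos (εc u) + zpos (-δ u) * zpos (-εc u) := by
  have hsk : ∀ v, B u v = -B v u := fun v => by
    have := congrFun (congrFun hB v) u
    simpa [Matrix.transpose_apply] using this
  have huu : B u u = 0 := by have := hsk u; omega
  have z0 : zpos 0 = 0 := by simp [zpos]
  have key : dotProd (deltaMut B u δ) γ' - dotProd δ γ
      = -δ u * (γ' u + γ u) + posPair γ B u * δ u - rowMul γ B u * zpos (δ u) := by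
    have h1 : ∀ v, deltaMut B u δ v * γ' v = δ v * γ v + γ v * zpos (B v u) * δ u
        - γ v * B v u * zpos (δ u) + (if v = u then -δ u * (γ' u + γ u) else 0) := by
      intro v
      by_cases h : v = u
      · subst h
        simp only [deltaMut, if_true, huu, z0]
        ring
      · simp only [deltaMut, h, if_false, hγ'ne v h, hsk v, neg_neg]
        ring
    simp only [dotProd, posPair, rowMul, h1, Finset.sum_add_distrib, Finset.sum_sub_distrib,
      Finset.sum_mul, Finset.sum_ite_eq', Finset.mem_univ, if_true]
    ring
  have hR : rowMul γ B u = lam u - δ u + εc u := by rw [hlam]; ring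
  rw [key, hγ'u, hR]
  have hl := zpos_eq_aux (lam u)
  have he := zpos_eq_aux (εc u)
  rw [hl, he]
  rcases le_total (δ u) 0 with h | h
  · have a : zpos (δ u) = 0 := by unfold zpos; omega
    have b : zpos (-δ u) = -δ u := by unfold zpos; omega
    rw [a, b]; ring
  · have a : zpos (δ u) = δ u := by unfold zpos; omega
    have b : zpos (-δ u) = 0 := by unfold zpos; omega
    rw [a, b]; ring
end

section
/- (Combinatorial identity underlying the invariance of h_l in Proposition 5.3.) Let B be a skew-symmetric n×n integer matrix, u ∈ {1,…,n}, and δ, ε̌, γ ∈ ℤ^n. Set λ := δ − ε̌ + γB, let ε̌' := μ̌_u(ε̌), and define γ' ∈ ℤ^n by γ'(v) = γ(v) for v ≠ u and γ'(u) = γ[b_u]_+ − γ(u) + [δ(u)]_+ + [−ε̌(u)]_+ − [λ(u)]_+. Then ε̌'·γ' − ε̌·γ = [−δ(u)]_+[−ε̌(u)]_+ − [δ(u)]_+[ε̌(u)]_+ − [−λ(u)]_+[−ε̌(u)]_+ + [λ(u)]_+[ε̌(u)]_+. -/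
open Matrix

/-- Proposition 5.3, combinatorial identity underlying the invariance of `h_l`. -/
theorem h_l_identity {n : ℕ} (B : Matrix (Fin n) (Fin n) ℤ)
    (hB : Bᵀ = -B) (u : Fin n) (δ εc γ lam γ' : Fin n → ℤ)
    (hlam : lam = fun w => δ w - εc w + rowMul γ B w)
    (hγ'ne : ∀ v, v ≠ u → γ' v = γ v)
    (hγ'u : γ' u = posPair γ B u - γ u + zpos (δ u) + zpos (-εc u) - zpos (lam u)) :
    dotProd (checkMut B u εc) γ' - dotProd εc γ =
      zpos (-δ u) * zpos (-εc u) - zpos (δ u) * zpos (εc u)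
        - zpos (-lam u) * zpos (-εc u) + zpos (lam u) * zpos (εc u) := by
  have hs : ∀ v, B u v = -B v u := fun v => by
    have := congrFun (congrFun hB v) u
    simpa [Matrix.transpose_apply] using this
  have h0 : B u u = 0 := by have := hs u; omega
  have key : dotProd (checkMut B u εc) γ' = dotProd εc γ + posPair γ B u * εc u
      + rowMul γ B u * zpos (-εc u) + (-εc u * γ' u - εc u * γ u) := by
    have h1 : ∀ v, checkMut B u εc v * γ' v = εc v * γ v + γ v * zpos (B v u) * εc u
        + γ v * B v u * zpos (-εc u)
        + (if v = u then -εc u * γ' u - εc u * γ u else 0) := by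
      intro v
      by_cases h : v = u
      · subst h
        simp [checkMut, h0, zpos]
      · simp only [checkMut, h, if_false, hγ'ne v h, hs v, neg_neg]
        ring
    simp only [dotProd, posPair, rowMul]
    rw [Finset.sum_congr rfl (fun v _ => h1 v)]
    simp only [Finset.sum_add_distrib, Finset.sum_mul, Finset.sum_ite_eq', Finset.mem_univ,
      if_true]
  have hl : rowMul γ B u = lam u - δ u + εc u := by rw [hlam]; ring
  have hz : ∀ x : ℤ, zpos (-x) = zpos x - x := by
    intro x; simp only [zpos]; omega
  have he : zpos (εc u) * (zpos (εc u) - εc u) = 0 := by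
    simp only [zpos]
    rcases le_total (εc u) 0 with h | h
    · simp [max_eq_right h]
    · simp [max_eq_left h]
  rw [key, hγ'u, hl, hz, hz, hz]
  ring
end

section
/- (Combinatorial identity underlying the invariance of e_r in Proposition 5.3.) Let B be a skew-symmetric n×n integer matrix, u ∈ {1,…,n}, and δ, ε, γ ∈ ℤ^n. Set λ := δ + ε + γB, let ε' := μ_u(ε), and define γ' ∈ ℤ^n by γ'(v) = γ(v) for v ≠ u and γ'(u) = γ[b_u]_+ − γ(u) + [δ(u)]_+ + [ε(u)]_+ − [λ(u)]_+. Then ε'·γ' − ε·γ = [δ(u)]_+[−ε(u)]_+ − [−δ(u)]_+[ε(u)]_+ − [λ(u)]_+[−ε(u)]_+ + [−λ(u)]_+[ε(u)]_+. -/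
open Matrix

/-- Proposition 5.3, combinatorial identity underlying the invariance of `e_r`. -/
theorem e_r_identity {n : ℕ} (B : Matrix (Fin n) (Fin n) ℤ)
    (hB : Bᵀ = -B) (u : Fin n) (δ ε γ lam γ' : Fin n → ℤ)
    (hlam : lam = fun w => δ w + ε w + rowMul γ B w)
    (hγ'ne : ∀ v, v ≠ u → γ' v = γ v)
    (hγ'u : γ' u = posPair γ B u - γ u + zpos (δ u) + zpos (ε u) - zpos (lam u)) :
    dotProd (deltaMut B u ε) γ' - dotProd ε γ =
      zpos (δ u) * zpos (-ε u) - zpos (-δ u) * zpos (ε u)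
        - zpos (lam u) * zpos (-ε u) + zpos (-lam u) * zpos (ε u) := by
  have hs : ∀ v, B u v = -B v u := fun v => by
    have h := congrFun (congrFun hB v) u
    simpa using h
  have huu : B u u = 0 := by have := hs u; omega
  have hz : ∀ x : ℤ, x = zpos x - zpos (-x) := fun x => by
    unfold zpos; omega
  have key : ∀ v, deltaMut B u ε v * γ' v = ε v * γ v + ε u * (γ v * zpos (B v u))
      - zpos (ε u) * (γ v * B v u)
      + (if v = u then -ε u * γ' u - ε u * γ u else 0) := by
    intro v
    by_cases h : v = u
    · subst h
      have h0 : zpos 0 = 0 := by simp [zpos]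
      simp only [deltaMut, if_true, huu, h0]
      ring
    · simp only [deltaMut, if_neg h, hγ'ne v h, hs v, neg_neg]
      ring
  have hsum : dotProd (deltaMut B u ε) γ' = dotProd ε γ + ε u * posPair γ B u
      - zpos (ε u) * rowMul γ B u + (-ε u * γ' u - ε u * γ u) := by
    unfold dotProd posPair rowMul
    rw [Finset.sum_congr rfl (fun v _ => key v)]
    simp only [Finset.sum_add_distrib, Finset.sum_sub_distrib, Finset.mul_sum,
      Finset.sum_ite_eq', Finset.mem_univ, if_true]
  have hl : rowMul γ B u = lam u - δ u - ε u := by rw [hlam]; ring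
  rw [hsum, hγ'u, hl]
  have h1 := hz (δ u)
  have h2 := hz (ε u)
  have h3 := hz (lam u)
  linear_combination zpos (ε u) * h1 + (zpos (lam u) - zpos (δ u)) * h2 - zpos (ε u) * h3
end

section
/- (Combinatorial identity underlying the invariance of ě_r in Proposition 5.3.) Let B be a skew-symmetric n×n integer matrix, u ∈ {1,…,n}, and δ, ε, γ ∈ ℤ^n. Set λ := δ + ε + γB, let δ' := μ_u(δ), and define γ' ∈ ℤ^n by γ'(v) = γ(v) for v ≠ u and γ'(u) = γ[b_u]_+ − γ(u) + [δ(u)]_+ + [ε(u)]_+ − [λ(u)]_+. Then δ'·γ' − δ·γ = [δ(u)]_+[−λ(u)]_+ − [−δ(u)]_+[λ(u)]_+ − [δ(u)]_+[−ε(u)]_+ + [−δ(u)]_+[ε(u)]_+. -/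
open Matrix

/-- Proposition 5.3, combinatorial identity underlying the invariance of `ě_r`. -/
theorem echeck_r_identity {n : ℕ} (B : Matrix (Fin n) (Fin n) ℤ)
    (hB : Bᵀ = -B) (u : Fin n) (δ ε γ lam γ' : Fin n → ℤ)
    (hlam : lam = fun w => δ w + ε w + rowMul γ B w)
    (hγ'ne : ∀ v, v ≠ u → γ' v = γ v)
    (hγ'u : γ' u = posPair γ B u - γ u + zpos (δ u) + zpos (ε u) - zpos (lam u)) :
    dotProd (deltaMut B u δ) γ' - dotProd δ γ =
      zpos (δ u) * zpos (-lam u) - zpos (-δ u) * zpos (lam u)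
        - zpos (δ u) * zpos (-ε u) + zpos (-δ u) * zpos (ε u) := by
  have hBv : ∀ v, B u v = -B v u := fun v => by
    have := congrFun (congrFun hB v) u
    simpa using this
  have h0 : B u u = 0 := by
    have := hBv u
    omega
  have key : ∀ v, deltaMut B u δ v * γ' v - δ v * γ v =
      δ u * (γ v * zpos (B v u)) - zpos (δ u) * (γ v * B v u)
        + (if v = u then -δ u * γ' u - δ u * γ u else 0) := by
    intro v
    by_cases hv : v = u
    · subst hv
      simp [deltaMut, h0, zpos]
    · simp only [deltaMut, hv, if_false, hγ'ne v hv, hBv v, neg_neg]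
      ring
  have hsum : dotProd (deltaMut B u δ) γ' - dotProd δ γ =
      δ u * posPair γ B u - zpos (δ u) * rowMul γ B u + (-δ u * γ' u - δ u * γ u) := by
    unfold dotProd posPair rowMul
    rw [← Finset.sum_sub_distrib, Finset.sum_congr rfl (fun v _ => key v),
      Finset.sum_add_distrib, Finset.sum_sub_distrib, Finset.mul_sum, Finset.mul_sum]
    simp
  have hR : rowMul γ B u = lam u - δ u - ε u := by
    rw [hlam]
    ring
  have hz : ∀ x : ℤ, zpos (-x) = zpos x - x := by
    intro x
    unfold zpos
    omega
  rw [hsum, hγ'u, hR, hz, hz, hz]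
  ring
end

section
/- (Involutivity of δ-vector mutation.) Let B be a skew-symmetric n×n integer matrix, u ∈ {1,…,n}, and δ ∈ ℤ^n. Let δ' := μ_u(δ) be the δ-vector mutation of δ with respect to B, and let δ'' be the δ-vector mutation of δ' at the same vertex u with respect to the mutated matrix μ_u(B). Then δ'' = δ. -/
open Matrix

/-- Involutivity of δ-vector mutation: mutating at `u` with respect to `B` and then
again at `u` with respect to `μ_u(B)` returns the original vector. -/
theorem deltaMut_involutive {n : ℕ} (B : Matrix (Fin n) (Fin n) ℤ)
    (hB : Bᵀ = -B) (u : Fin n) (δ : Fin n → ℤ) :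
    deltaMut (matMut B u) u (deltaMut B u δ) = δ := by
  have key : ∀ x : ℤ, zpos x - zpos (-x) = x := by
    intro x
    unfold zpos
    omega
  funext v
  by_cases h : v = u
  · subst h
    simp [deltaMut]
  · simp only [deltaMut, matMut, if_neg h, if_true, true_or, neg_neg]
    linear_combination (-δ u) * key (B u v) + B u v * key (δ u)
end

section
/- (Core of Lemma 3.1: simultaneous attainment of the general rank for a fixed pair of modules.) Let k be an infinite field, A an associative k-algebra, and M, N left A-modules that are finite-dimensional as k-vector spaces. Let e_1, …, e_r be finitely many idempotents of A. Then there exists an A-module homomorphism φ : M → N such that for every i ∈ {1,…,r}, dim_k φ(e_i·M) = max { dim_k ψ(e_i·M) : ψ ∈ Hom_A(M,N) }. That is, a single homomorphism simultaneously attains the maximal possible dimension of the image at each idempotent. -/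
theorem bad_finite_aux {k V W : Type*} [Field k] [AddCommGroup V] [Module k V]
    [AddCommGroup W] [Module k W] [FiniteDimensional k V] [FiniteDimensional k W]
    (f g : V →ₗ[k] W) :
    {t : k | Module.finrank k (LinearMap.range (f + t • g)) <
      Module.finrank k (LinearMap.range g)}.Finite := by
  obtain ⟨s, hs⟩ := g.rangeRestrict.exists_rightInverse_of_surjective g.range_rangeRestrict
  obtain ⟨p, hp⟩ := (LinearMap.range g).subtype.exists_leftInverse_of_injective
    (Submodule.ker_subtype _)
  let L : Module.End k (LinearMap.range g) := p ∘ₗ f ∘ₗ s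
  have hfin : {μ : k | Module.End.HasEigenvalue L μ}.Finite := Module.End.finite_hasEigenvalue L
  refine (hfin.preimage (f := fun t : k => -t) neg_injective.injOn).subset ?_
  intro t ht
  by_contra hne
  have hne : ¬ Module.End.HasEigenvalue L (-t) := hne
  have hgs : ∀ x, p (g (s x)) = x := by
    intro x
    have h1 := LinearMap.congr_fun hs x
    have h2 := LinearMap.congr_fun hp x
    have h3 : g (s x) = x := congrArg Subtype.val h1
    rw [h3]; exact h2
  have hinj : Function.Injective ((f + t • g) ∘ₗ s) := by
    rw [← LinearMap.ker_eq_bot, LinearMap.ker_eq_bot']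
    intro x hx
    by_contra hx0
    apply hne
    refine Module.End.hasEigenvalue_of_hasEigenvector (x := x) ⟨?_, hx0⟩
    rw [Module.End.mem_eigenspace_iff]
    have := congrArg p hx
    simp only [LinearMap.comp_apply, LinearMap.add_apply, LinearMap.smul_apply, map_add,
      map_smul, hgs, map_zero] at this
    rw [neg_smul]
    exact eq_neg_of_add_eq_zero_left this
  have h1 := LinearMap.finrank_range_of_inj hinj
  have h2 := Submodule.finrank_mono (LinearMap.range_comp_le_range s (f + t • g))
  rw [Set.mem_ofPred_eq] at ht
  omega

theorem bad_finite_aux2 {k V W : Type*} [Field k] [AddCommGroup V] [Module k V]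
    [AddCommGroup W] [Module k W] [FiniteDimensional k V] [FiniteDimensional k W]
    (f g : V →ₗ[k] W) :
    {t : k | Module.finrank k (LinearMap.range (f + t • g)) <
      Module.finrank k (LinearMap.range f)}.Finite := by
  refine (((bad_finite_aux g f).preimage (f := fun t : k => t⁻¹)
    inv_injective.injOn).union (Set.finite_singleton 0)).subset ?_
  intro t ht
  by_cases h0 : t = 0
  · right; exact h0
  · left
    have : f + t • g = t • (g + t⁻¹ • f) := by
      rw [smul_add, smul_smul, mul_inv_cancel₀ h0, one_smul, add_comm]
    rw [Set.mem_ofPred_eq] at ht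
    rw [this, LinearMap.range_smul _ _ h0] at ht
    exact ht

/-- Lemma 3.1 core: over an infinite field, a single `A`-module homomorphism `φ : M → N`
simultaneously attains, for each of finitely many idempotents `e i` of `A`, the maximal
possible dimension of the image `φ(e_i · M)`. -/
theorem general_rank_attained (k : Type*) [Field k] [Infinite k]
    (A : Type*) [Ring A] [Algebra k A]
    (M N : Type*) [AddCommGroup M] [Module k M] [Module A M] [IsScalarTower k A M]
    [AddCommGroup N] [Module k N] [Module A N] [IsScalarTower k A N]
    [FiniteDimensional k M] [FiniteDimensional k N]
    (r : ℕ) (e : Fin r → A) (he : ∀ i, IsIdempotentElem (e i)) :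
    ∃ φ : M →ₗ[A] N, ∀ i : Fin r, ∀ ψ : M →ₗ[A] N,
      Module.finrank k (LinearMap.range
          ((ψ.restrictScalars k) ∘ₗ ((Algebra.lsmul k k M (e i) : Module.End k M)))) ≤
        Module.finrank k (LinearMap.range
          ((φ.restrictScalars k) ∘ₗ ((Algebra.lsmul k k M (e i) : Module.End k M)))) := by
  classical
  haveI : SMulCommClass A k N := IsScalarTower.to_smulCommClass'
  let F : Fin r → (M →ₗ[A] N) → (M →ₗ[k] N) := fun i ψ =>
    (ψ.restrictScalars k) ∘ₗ ((Algebra.lsmul k k M (e i) : Module.End k M))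
  have hF : ∀ i φ ψ (t : k), F i (φ + t • ψ) = F i φ + t • F i ψ := by
    intro i φ ψ t
    ext x
    simp [F]
  let R : Fin r → (M →ₗ[A] N) → ℕ := fun i ψ => Module.finrank k (LinearMap.range (F i ψ))
  have hmax : ∀ i, ∃ φ, ∀ ψ, R i ψ ≤ R i φ := by
    intro i
    have hb : BddAbove (Set.range (R i)) := by
      refine ⟨Module.finrank k N, ?_⟩
      rintro _ ⟨ψ, rfl⟩
      exact Submodule.finrank_le _
    obtain ⟨φ, hφ⟩ := Nat.sSup_mem (Set.range_nonempty (R i)) hb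
    exact ⟨φ, fun ψ => hφ ▸ le_csSup hb ⟨ψ, rfl⟩⟩
  suffices h : ∀ S : Finset (Fin r), ∃ φ, ∀ i ∈ S, ∀ ψ, R i ψ ≤ R i φ by
    obtain ⟨φ, hφ⟩ := h Finset.univ
    exact ⟨φ, fun i ψ => hφ i (Finset.mem_univ i) ψ⟩
  intro S
  induction S using Finset.induction_on with
  | empty => exact ⟨0, by simp⟩
  | insert a S _ ih =>
    obtain ⟨φ, hφ⟩ := ih
    obtain ⟨χ, hχ⟩ := hmax a
    have hfin := (bad_finite_aux (F a φ) (F a χ)).union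
      (Set.finite_iUnion fun i : Fin r => bad_finite_aux2 (F i φ) (F i χ))
    obtain ⟨t, ht⟩ := hfin.exists_notMem
    simp only [Set.mem_union, Set.mem_iUnion, Set.mem_ofPred_eq, not_or, not_exists, not_lt,
      ← hF] at ht
    refine ⟨φ + t • χ, fun i hi ψ => ?_⟩
    rcases Finset.mem_insert.1 hi with rfl | hi
    · exact (hχ ψ).trans ht.1
    · exact (hφ i hi ψ).trans (ht.2 i)
end
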